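/- Let l ≥ 1 be an integer, let (c_j)_{|j|<l} be real numbers with |c_j| ≤ 1 for all |j| < l and Σ_{|j|<l} c_j = 0, and let τ₀ ∈ ℝ. Then for every 0 < α < βc₁ l / 4: ∫_{ℝ^{2l−1}} exp( α ( (1/l) Σ_{|j|<l} c_j r_j )² ) dλ^{2l−1}_{β,τ₀} ≤ ( 1 − 4α/(βc₁ l) )^{−1/2}, where the product measure has i.i.d. coordinates (r_j)_{|j|<l} each distributed as λ_{β,τ₀}. -/

import Mathlib

open MeasureTheory Real Set Finset
open scoped ENNReal

/-- The canonical Gibbs function `G(τ) = log ∫ exp(-βV(r) + βτr) dr`. -/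
noncomputable def gibbsG (β : ℝ) (V : ℝ → ℝ) (τ : ℝ) : ℝ :=
  Real.log (∫ r : ℝ, Real.exp (-β * V r + β * τ * r))

/-- One-site Gibbs density `exp(-βV(r) + βτr - G(τ))`. -/
noncomputable def gibbsDensity (β : ℝ) (V : ℝ → ℝ) (τ r : ℝ) : ℝ :=
  Real.exp (-β * V r + β * τ * r - gibbsG β V τ)

/-- The `n`-fold product Gibbs measure `λ^n_{β,τ}` on `ℝ^n`. -/
noncomputable def gibbsPi (β : ℝ) (V : ℝ → ℝ) (τ : ℝ) (n : ℕ) : Measure (Fin n → ℝ) :=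
  volume.withDensity fun x => ENNReal.ofReal (∏ i, gibbsDensity β V τ (x i))

open ProbabilityTheory
open scoped NNReal

/-- A centered variable whose variance under every exponential tilt is at most `c` is sub-Gaussian
with parameter `c`. -/
lemma ProbabilityTheory.hasSubgaussianMGF_of_variance_tilted_le {Ω : Type*} {mΩ : MeasurableSpace Ω}
    {μ : Measure Ω} [IsProbabilityMeasure μ] {X : Ω → ℝ} {c : ℝ≥0}
    (hexp : ∀ t : ℝ, Integrable (fun ω => Real.exp (t * X ω)) μ) (hmean : ∫ ω, X ω ∂μ = 0)
    (hvar : ∀ t : ℝ, Var[X; μ.tilted fun ω => t * X ω] ≤ c) :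
    HasSubgaussianMGF X c μ := by
  have hpos {Y : Ω → ℝ} (hexpY : ∀ t : ℝ, Integrable (fun ω => Real.exp (t * Y ω)) μ)
      (hmeanY : ∫ ω, Y ω ∂μ = 0) (hvarY : ∀ t : ℝ, Var[Y; μ.tilted fun ω => t * Y ω] ≤ c)
      {t : ℝ} (ht : 0 < t) : mgf Y μ t ≤ Real.exp (c * t ^ 2 / 2) := by
    have huniv : integrableExpSet Y μ = Set.univ := Set.eq_univ_of_forall hexpY
    obtain ⟨u, -, hu⟩ := exists_cgf_eq_iteratedDeriv_two_cgf_mul ht hmeanY (by simp [huniv])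
    rw [← exp_cgf (hexpY t), Real.exp_le_exp, hu, ← variance_tilted_mul (by simp [huniv])]
    gcongr
    exact hvarY u
  refine ⟨hexp, fun t => ?_⟩
  rcases lt_trichotomy 0 t with ht | rfl | ht
  · exact hpos hexp hmean hvar ht
  · simp
  · have h := hpos (Y := -X) (fun s => by simpa using hexp (-s)) (by simp [integral_neg, hmean])
      (fun s => by simpa [variance_neg] using hvar (-s)) (neg_pos.2 ht)
    simpa [mgf] using h

section StronglyConvexPotential

variable {W W' : ℝ → ℝ} {κ K : ℝ}

/-- A potential whose derivative grows at rate at least `κ` lies above its tangent parabolas. -/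
lemma tangent_parabola_le (hW : ∀ x, HasDerivAt W (W' x) x)
    (hlo : ∀ x y, x ≤ y → κ * (y - x) ≤ W' y - W' x) (x : ℝ) :
    W 0 + W' 0 * x + κ / 2 * x ^ 2 ≤ W x := by
  set g : ℝ → ℝ := fun y => W y - W' 0 * y - κ / 2 * y ^ 2 with hg
  have hgd (y : ℝ) : HasDerivAt g (W' y - W' 0 - κ * y) y := by
    have h := ((hW y).sub ((hasDerivAt_id y).const_mul (W' 0))).sub
      (((hasDerivAt_id y).pow 2).const_mul (κ / 2))
    convert! h using 1
    simp
    ring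
  have hgc : Continuous g := continuous_iff_continuousAt.2 fun y => (hgd y).continuousAt
  have key : g 0 ≤ g x := by
    rcases lt_trichotomy x 0 with hx | rfl | hx
    · obtain ⟨ξ, hξ, h⟩ := exists_hasDerivAt_eq_slope g _ hx hgc.continuousOn fun y _ => hgd y
      have h1 := hlo ξ 0 hξ.2.le
      rw [eq_div_iff (by linarith)] at h
      nlinarith
    · exact le_rfl
    · obtain ⟨ξ, hξ, h⟩ := exists_hasDerivAt_eq_slope g _ hx hgc.continuousOn fun y _ => hgd y
      have h1 := hlo 0 ξ hξ.1.le
      rw [eq_div_iff (by linarith)] at h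
      nlinarith
  simp only [hg] at key
  linarith

lemma integrable_exp_neg_of_strongly_convex (hκ : 0 < κ) (hW : ∀ x, HasDerivAt W (W' x) x)
    (hlo : ∀ x y, x ≤ y → κ * (y - x) ≤ W' y - W' x) :
    Integrable fun x => Real.exp (-W x) := by
  have hWc : Continuous W := continuous_iff_continuousAt.2 fun y => (hW y).continuousAt
  refine ((integrable_exp_neg_mul_sq (b := κ / 4) (by positivity)).const_mul
    (Real.exp (-W 0 + W' 0 ^ 2 / κ))).mono' (by fun_prop) (ae_of_all _ fun x => ?_)
  rw [Real.norm_eq_abs, Real.abs_exp, ← Real.exp_add, Real.exp_le_exp]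
  have h := tangent_parabola_le hW hlo x
  have h2 : 0 ≤ (W' 0 + κ / 2 * x) ^ 2 / κ := by positivity
  have h3 : (W' 0 + κ / 2 * x) ^ 2 / κ = W' 0 ^ 2 / κ + W' 0 * x + κ / 4 * x ^ 2 := by
    field_simp
    ring
  linarith

lemma sub_linear_hasDerivAt (hW : ∀ x, HasDerivAt W (W' x) x) (t a x : ℝ) :
    HasDerivAt (fun x => W x - t * (x - a)) (W' x - t) x := by
  convert! (hW x).sub (((hasDerivAt_id x).sub_const a).const_mul t) using 1
  simp

lemma integrable_exp_mul_tilted_of_strongly_convex (hκ : 0 < κ)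
    (hW : ∀ x, HasDerivAt W (W' x) x)
    (hlo : ∀ x y, x ≤ y → κ * (y - x) ≤ W' y - W' x) (t a : ℝ) :
    Integrable (fun x => Real.exp (t * (x - a))) (volume.tilted fun x => -W x) := by
  rw [integrable_tilted_iff (integrable_exp_neg_of_strongly_convex hκ hW hlo)]
  refine (integrable_exp_neg_of_strongly_convex (W' := fun x => W' x - t) hκ
    (sub_linear_hasDerivAt hW t a) fun x y hxy => by simpa using hlo x y hxy).congr
    (ae_of_all _ fun x => ?_)
  simp only [smul_eq_mul, ← Real.exp_add]
  ring_nf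

lemma integrable_pow_tilted_of_strongly_convex (hκ : 0 < κ) (hW : ∀ x, HasDerivAt W (W' x) x)
    (hlo : ∀ x y, x ≤ y → κ * (y - x) ≤ W' y - W' x) (n : ℕ) :
    Integrable (fun x => x ^ n) (volume.tilted fun x => -W x) := by
  refine integrable_pow_of_mem_interior_integrableExpSet (X := fun x : ℝ => x) ?_ n
  have h : integrableExpSet (fun x : ℝ => x) (volume.tilted fun x => -W x) = Set.univ :=
    Set.eq_univ_of_forall fun t => by
      simpa [integrableExpSet] using integrable_exp_mul_tilted_of_strongly_convex hκ hW hlo t 0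
  simp [h]

/-- The one-dimensional Poincaré (Brascamp–Lieb) bound for the variance of the identity. -/
lemma variance_tilted_le_of_strongly_convex (hκ : 0 < κ) (hW : ∀ x, HasDerivAt W (W' x) x)
    (hlo : ∀ x y, x ≤ y → κ * (y - x) ≤ W' y - W' x)
    (hup : ∀ x y, x ≤ y → W' y - W' x ≤ K * (y - x)) (hW'c : Continuous W') :
    Var[fun x => x; volume.tilted fun x => -W x] ≤ κ⁻¹ := by
  set ν : Measure ℝ := volume.tilted fun x => -W x with hν
  have hint := integrable_exp_neg_of_strongly_convex hκ hW hlo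
  have : IsProbabilityMeasure ν := isProbabilityMeasure_tilted hint
  have hpow := integrable_pow_tilted_of_strongly_convex hκ hW hlo
  have hid : Integrable (fun x : ℝ => x) ν := by simpa using hpow 1
  set m : ℝ := ∫ x, x ∂ν with hm
  have hK : κ ≤ K := by
    have h1 := hlo 0 1 zero_le_one
    have h2 := hup 0 1 zero_le_one
    linarith
  have hprod (x : ℝ) : κ * (x - m) ^ 2 ≤ (x - m) * (W' x - W' m) ∧
      (x - m) * (W' x - W' m) ≤ K * (x - m) ^ 2 := by
    rcases le_total m x with h | h
    · have h1 := hlo m x h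
      have h2 := hup m x h
      constructor <;> nlinarith
    · have h1 := hlo x m h
      have h2 := hup x m h
      constructor <;> nlinarith
  have hsq : Integrable (fun x => (x - m) ^ 2) ν := by
    have h := ((hpow 2).sub (hid.const_mul (2 * m))).add (integrable_const (m ^ 2))
    exact h.congr (ae_of_all _ fun x => by simp; ring)
  have hcentered : Integrable (fun x => x - m) ν := hid.sub (integrable_const m)
  have hcross : Integrable (fun x => (x - m) * (W' x - W' m)) ν := by
    refine (hsq.const_mul K).mono' (by fun_prop) (ae_of_all _ fun x => ?_)
    rw [Real.norm_eq_abs, abs_of_nonneg ((by positivity : 0 ≤ κ * (x - m) ^ 2).trans (hprod x).1)]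
    exact (hprod x).2
  have hlin : Integrable (fun x => (x - m) * W' x) ν :=
    (hcross.add (hcentered.mul_const (W' m))).congr (ae_of_all _ fun x => by simp; ring)
  have hmean : ∫ x, (x - m) ∂ν = 0 := by
    rw [integral_sub hid (integrable_const m)]
    simp [hm]
  have hparts : ∫ x, (1 - (x - m) * W' x) ∂ν = 0 := by
    have hd (x : ℝ) : HasDerivAt (fun x => Real.exp (-W x) * (x - m))
        (Real.exp (-W x) * (1 - (x - m) * W' x)) x := by
      have h := ((hW x).neg.exp).mul ((hasDerivAt_id x).sub_const m)
      convert! h using 1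
      simp
      ring
    have h0 := integral_eq_zero_of_hasDerivAt_of_integrable hd
      ((integrable_tilted_iff hint _).1 ((integrable_const 1).sub hlin))
      ((integrable_tilted_iff hint _).1 hcentered)
    rw [hν, integral_tilted]
    simp only [smul_eq_mul, div_mul_eq_mul_div]
    rw [integral_div, h0, zero_div]
  have hone : ∫ x, (x - m) * (W' x - W' m) ∂ν = 1 := by
    have h : ∀ x, (x - m) * (W' x - W' m) = 1 - ((1 - (x - m) * W' x) + W' m * (x - m)) :=
      fun x => by ring
    have hI : Integrable (fun x => 1 - (x - m) * W' x) ν := (integrable_const 1).sub hlin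
    simp_rw [h]
    rw [integral_sub (integrable_const 1) (by exact hI.add (hcentered.const_mul (W' m))),
      integral_add hI (hcentered.const_mul _), hparts, integral_const_mul, hmean]
    simp
  rw [variance_eq_integral aemeasurable_id', ← hm, ← one_div, le_div_iff₀' hκ, ← integral_const_mul,
    ← hone]
  exact integral_mono (hsq.const_mul κ) hcross fun x => (hprod x).1

/-- Bakry–Émery in dimension one: a strongly log-concave law is sub-Gaussian around its mean. -/
lemma hasSubgaussianMGF_tilted_of_strongly_convex (hκ : 0 < κ)
    (hW : ∀ x, HasDerivAt W (W' x) x)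
    (hlo : ∀ x y, x ≤ y → κ * (y - x) ≤ W' y - W' x)
    (hup : ∀ x y, x ≤ y → W' y - W' x ≤ K * (y - x)) (hW'c : Continuous W') :
    HasSubgaussianMGF (fun x => x - ∫ y, y ∂(volume.tilted fun x => -W x)) (Real.toNNReal κ⁻¹)
      (volume.tilted fun x => -W x) := by
  set ν : Measure ℝ := volume.tilted fun x => -W x with hν
  have hint := integrable_exp_neg_of_strongly_convex hκ hW hlo
  have : IsProbabilityMeasure ν := isProbabilityMeasure_tilted hint
  set m : ℝ := ∫ x, x ∂ν with hm
  have hexp (t : ℝ) : Integrable (fun x => Real.exp (t * (x - m))) ν :=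
    integrable_exp_mul_tilted_of_strongly_convex hκ hW hlo t m
  have hmean : ∫ x, (x - m) ∂ν = 0 := by
    have hid : Integrable (fun x : ℝ => x) ν := by
      simpa using integrable_pow_tilted_of_strongly_convex hκ hW hlo 1
    rw [integral_sub hid (integrable_const m)]
    simp [hm]
  refine hasSubgaussianMGF_of_variance_tilted_le hexp hmean fun u => ?_
  have : IsProbabilityMeasure (ν.tilted fun x => u * (x - m)) :=
    isProbabilityMeasure_tilted (hexp u)
  rw [variance_sub_const (X := fun x => x) aestronglyMeasurable_id, hν, tilted_tilted hint,
    Real.coe_toNNReal _ (by positivity)]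
  convert! variance_tilted_le_of_strongly_convex (W' := fun x => W' x - u) hκ
    (sub_linear_hasDerivAt hW u m) (fun x y hxy => by simpa using hlo x y hxy)
    (fun x y hxy => by simpa using hup x y hxy) (by fun_prop) using 3
  ext x
  simp
  ring

end StronglyConvexPotential

section SquareExponential

lemma lintegral_exp_mul_sq_gaussianReal {b : ℝ} (hb : b < 1 / 2) :
    ∫⁻ g, ENNReal.ofReal (Real.exp (b * g ^ 2)) ∂(gaussianReal 0 1) =
      ENNReal.ofReal ((1 - 2 * b) ^ (-(1 : ℝ) / 2)) := by
  rw [gaussianReal_of_var_ne_zero _ one_ne_zero,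
    lintegral_withDensity_eq_lintegral_mul _ (measurable_gaussianPDF 0 1) (by fun_prop)]
  have h (g : ℝ) : (gaussianPDF 0 1 * fun g => ENNReal.ofReal (Real.exp (b * g ^ 2))) g =
      ENNReal.ofReal ((√(2 * π))⁻¹ * Real.exp (-(1 / 2 - b) * g ^ 2)) := by
    rw [Pi.mul_apply, gaussianPDF, ← ENNReal.ofReal_mul (gaussianPDFReal_nonneg _ _ _),
      gaussianPDFReal, mul_assoc, ← Real.exp_add]
    simp
    ring_nf
  simp_rw [h]
  rw [← ofReal_integral_eq_lintegral_ofReal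
    ((integrable_exp_neg_mul_sq (by linarith)).const_mul _) (ae_of_all _ fun g => by positivity),
    integral_const_mul, integral_gaussian]
  congr 1
  have hb' : 0 < 1 - 2 * b := by linarith
  rw [neg_div, Real.rpow_neg hb'.le, ← Real.sqrt_eq_rpow, ← Real.sqrt_inv, ← Real.sqrt_inv,
    ← Real.sqrt_mul (by positivity)]
  congr 1
  have : (1 / 2 - b) ≠ 0 := by linarith
  field_simp

/-- A sub-Gaussian variable has the same bound on its square-exponential moments as a centered
Gaussian. -/
lemma ProbabilityTheory.HasSubgaussianMGF.lintegral_exp_mul_sq_le {Ω : Type*}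
    {mΩ : MeasurableSpace Ω}
    {μ : Measure Ω} [SFinite μ] {Y : Ω → ℝ} {C : ℝ≥0} (hY : HasSubgaussianMGF Y C μ)
    {α : ℝ} (hα : 0 ≤ α) (hαC : 2 * α * C < 1) :
    ∫⁻ ω, ENNReal.ofReal (Real.exp (α * Y ω ^ 2)) ∂μ ≤
      ENNReal.ofReal ((1 - 2 * α * C) ^ (-(1 : ℝ) / 2)) := by
  have hYm : AEMeasurable Y μ := hY.aemeasurable
  have hlin (ω : Ω) : ENNReal.ofReal (Real.exp (α * Y ω ^ 2)) =
      ∫⁻ g, ENNReal.ofReal (Real.exp ((√(2 * α) * Y ω) * g)) ∂(gaussianReal 0 1) := by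
    rw [← ofReal_integral_eq_lintegral_ofReal (integrable_exp_mul_gaussianReal _)
      (ae_of_all _ fun g => by positivity)]
    have h := congrFun (mgf_fun_id_gaussianReal (μ := 0) (v := 1)) (√(2 * α) * Y ω)
    rw [mgf] at h
    rw [h, mul_pow, Real.sq_sqrt (by positivity)]
    simp
    ring_nf
  simp_rw [hlin]
  rw [lintegral_lintegral_swap (by fun_prop)]
  calc
    _ ≤ ∫⁻ g, ENNReal.ofReal (Real.exp (α * C * g ^ 2)) ∂(gaussianReal 0 1) := by
      refine lintegral_mono fun g => ?_
      have he (ω : Ω) : √(2 * α) * Y ω * g = (√(2 * α) * g) * Y ω := by ring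
      simp_rw [he]
      rw [← ofReal_integral_eq_lintegral_ofReal (hY.integrable_exp_mul _)
        (ae_of_all _ fun ω => by positivity)]
      refine ENNReal.ofReal_le_ofReal ((hY.mgf_le _).trans_eq ?_)
      rw [mul_pow, Real.sq_sqrt (by positivity)]
      ring_nf
    _ = _ := by
      rw [lintegral_exp_mul_sq_gaussianReal (by linarith)]
      ring_nf

end SquareExponential

lemma pi_withDensity_ofReal {ι : Type*} [Fintype ι] {f : ℝ → ℝ}
    (hf0 : ∀ x, 0 ≤ f x) (hfi : Integrable f) :
    Measure.pi (fun _ : ι => volume.withDensity fun x => ENNReal.ofReal (f x)) =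
      volume.withDensity fun x => ENNReal.ofReal (∏ i, f (x i)) := by
  have : IsFiniteMeasure (volume.withDensity fun x => ENNReal.ofReal (f x)) :=
    isFiniteMeasure_withDensity_ofReal hfi.2
  refine Measure.pi_eq fun s hs => ?_
  have hind (i : ι) : Integrable ((s i).indicator f) := hfi.indicator (hs i)
  rw [withDensity_apply _ (.univ_pi hs), ← lintegral_indicator (.univ_pi hs)]
  have h (x : ι → ℝ) : (Set.univ.pi s).indicator (fun x => ENNReal.ofReal (∏ i, f (x i))) x =
      ENNReal.ofReal (∏ i, (s i).indicator f (x i)) := by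
    by_cases hx : x ∈ Set.univ.pi s
    · rw [Set.indicator_of_mem hx]
      congr 1
      exact Finset.prod_congr rfl fun i _ => (Set.indicator_of_mem (hx i trivial) f).symm
    · rw [Set.indicator_of_notMem hx]
      obtain ⟨i, hi⟩ : ∃ i, x i ∉ s i := by simpa [Set.mem_pi] using hx
      rw [Finset.prod_eq_zero (Finset.mem_univ i) (Set.indicator_of_notMem hi f),
        ENNReal.ofReal_zero]
  simp_rw [h]
  rw [volume_pi, ← ofReal_integral_eq_lintegral_ofReal (Integrable.fintype_prod hind)
    (ae_of_all _ fun x => Finset.prod_nonneg fun i _ => Set.indicator_nonneg (fun _ _ => hf0 _) _),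
    integral_fintype_prod_eq_prod,
    ENNReal.ofReal_prod_of_nonneg fun i _ =>
      integral_nonneg fun x => Set.indicator_nonneg (fun _ _ => hf0 _) _]
  refine Finset.prod_congr rfl fun i _ => ?_
  rw [integral_indicator (hs i), withDensity_apply _ (hs i),
    ofReal_integral_eq_lintegral_ofReal hfi.integrableOn (ae_of_all _ hf0)]

/-- For weights `(c_j)` with `|c_j| ≤ 1` and `Σ c_j = 0` (indexed by
the `2l-1` sites of a block), and every `0 < α < βc₁l/4`,
`∫ exp(α ((1/l) Σⱼ cⱼ rⱼ)²) dλ^{2l-1}_{β,τ₀} ≤ (1 - 4α/(βc₁l))^{-1/2}`. -/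
theorem exponential_moment_centered_stretch_average
    (β c₁ c₂ : ℝ) (V : ℝ → ℝ)
    (hβ : 0 < β) (hc₁ : 0 < c₁) (hc₁₂ : c₁ ≤ c₂)
    (hV : ContDiff ℝ 2 V)
    (hV'' : ∀ r : ℝ, c₁ ≤ deriv (deriv V) r ∧ deriv (deriv V) r ≤ c₂)
    (l : ℕ) (hl : 1 ≤ l)
    (c : Fin (2 * l - 1) → ℝ) (hc : ∀ j, |c j| ≤ 1) (hcsum : (∑ j, c j) = 0)
    (τ₀ : ℝ) (α : ℝ) (hα : 0 < α) (hαl : α < β * c₁ * l / 4) :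
    (∫⁻ x, ENNReal.ofReal
        (Real.exp (α * ((1 / (l : ℝ)) * ∑ j, c j * x j) ^ 2))
        ∂(gibbsPi β V τ₀ (2 * l - 1))) ≤
      ENNReal.ofReal ((1 - 4 * α / (β * c₁ * l)) ^ (-(1 : ℝ) / 2)) := by
  have hκ : 0 < β * c₁ := by positivity
  have hl0 : (0 : ℝ) < l := by exact_mod_cast hl
  have hVd : Differentiable ℝ V := hV.differentiable (by norm_num)
  have hV'1 : ContDiff ℝ 1 (deriv V) := (contDiff_succ_iff_deriv (n := 1).1 hV).2.2
  have hV'd : Differentiable ℝ (deriv V) := hV'1.differentiable (by norm_num)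
  set W : ℝ → ℝ := fun r => β * V r - β * τ₀ * r with hWdef
  have hW (r : ℝ) : HasDerivAt W (β * deriv V r - β * τ₀) r := by
    convert! ((hVd r).hasDerivAt.const_mul β).sub ((hasDerivAt_id r).const_mul (β * τ₀)) using 1
    simp
  have hlo (x y : ℝ) (hxy : x ≤ y) :
      β * c₁ * (y - x) ≤ (β * deriv V y - β * τ₀) - (β * deriv V x - β * τ₀) := by
    have h := mul_sub_le_image_sub_of_le_deriv hV'd (fun r => (hV'' r).1) hxy
    nlinarith
  have hup (x y : ℝ) (hxy : x ≤ y) :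
      (β * deriv V y - β * τ₀) - (β * deriv V x - β * τ₀) ≤ β * c₂ * (y - x) := by
    have h := image_sub_le_mul_sub_of_deriv_le hV'd (fun r => (hV'' r).2) hxy
    nlinarith
  have hint := integrable_exp_neg_of_strongly_convex hκ hW hlo
  have hsub := hasSubgaussianMGF_tilted_of_strongly_convex hκ hW hlo hup
    (by have := hV'd.continuous; fun_prop)
  set ν : Measure ℝ := volume.tilted fun r => -W r with hν
  have : IsProbabilityMeasure ν := isProbabilityMeasure_tilted hint
  set m : ℝ := ∫ y, y ∂ν
  have hdens : gibbsDensity β V τ₀ = fun r => Real.exp (-W r) / ∫ r, Real.exp (-W r) := by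
    ext r
    have hexp : ∀ r, -β * V r + β * τ₀ * r = -W r := fun r => by simp only [hWdef]; ring
    simp_rw [gibbsDensity, gibbsG, hexp]
    rw [Real.exp_sub, Real.exp_log (integral_exp_pos hint)]
  have hpi : gibbsPi β V τ₀ (2 * l - 1) = Measure.pi fun _ => ν := by
    rw [gibbsPi, ← pi_withDensity_ofReal]
    · rw [hdens]
      rfl
    · exact fun _ => (Real.exp_pos _).le
    · rw [hdens]
      exact hint.div_const _
  have hsite (j : Fin (2 * l - 1)) : HasSubgaussianMGF (fun r => c j / l * (r - m))
      (Real.toNNReal ((c j / l) ^ 2 * (β * c₁)⁻¹)) ν := by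
    convert! hsub.const_mul (c j / l) using 1
    rw [Real.toNNReal_mul (sq_nonneg _)]
    congr 1
    exact Real.toNNReal_of_nonneg _
  have hY := HasSubgaussianMGF.sum_of_iIndepFun (μ := Measure.pi fun _ : Fin (2 * l - 1) => ν)
    (s := Finset.univ)
    (iIndepFun_pi (X := fun (j : Fin (2 * l - 1)) (r : ℝ) => c j / l * (r - m))
      fun j => by fun_prop)
    fun j _ => HasSubgaussianMGF.of_map (μ := Measure.pi fun _ : Fin (2 * l - 1) => ν)
      (Y := fun x => x j) (X := fun r : ℝ => c j / l * (r - m))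
      (measurable_pi_apply j).aemeasurable (by
        rw [(measurePreserving_eval _ j).map_eq]
        exact hsite j)
  have hsum (x : Fin (2 * l - 1) → ℝ) :
      1 / (l : ℝ) * ∑ j, c j * x j = ∑ j, c j / l * (x j - m) := by
    have h : ∑ j, c j / l * (x j - m) = 1 / (l : ℝ) * (∑ j, c j * x j - (∑ j, c j) * m) := by
      rw [Finset.sum_mul, ← Finset.sum_sub_distrib, Finset.mul_sum]
      exact Finset.sum_congr rfl fun j _ => by ring
    rw [h, hcsum, zero_mul, sub_zero]
  have hsq : ∑ j, (c j / l) ^ 2 ≤ 2 / (l : ℝ) :=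
    calc
      ∑ j, (c j / l) ^ 2 ≤ ∑ _j : Fin (2 * l - 1), 1 / (l : ℝ) ^ 2 := by
        gcongr with j
        rw [div_pow]
        gcongr
        exact (sq_le_one_iff_abs_le_one _).2 (hc j)
      _ = ((2 * l - 1 : ℕ) : ℝ) / (l : ℝ) ^ 2 := by simp [div_eq_mul_inv]
      _ ≤ ((2 * l : ℕ) : ℝ) / (l : ℝ) ^ 2 := by
        gcongr
        exact Nat.sub_le _ _
      _ = 2 / (l : ℝ) := by
        push_cast
        field_simp
  have hCle : 2 * α * ((∑ j, Real.toNNReal ((c j / l) ^ 2 * (β * c₁)⁻¹) : ℝ≥0) : ℝ) ≤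
      4 * α / (β * c₁ * l) := by
    rw [NNReal.coe_sum, Finset.sum_congr rfl fun j _ => Real.coe_toNNReal _ (by positivity),
      ← Finset.sum_mul]
    calc
      _ ≤ 2 * α * (2 / (l : ℝ) * (β * c₁)⁻¹) := by
        gcongr
      _ = _ := by
        field_simp
        norm_num
  have hlt : 4 * α / (β * c₁ * l) < 1 := by
    rw [div_lt_one (by positivity)]
    linarith
  simp_rw [hpi, hsum]
  refine (hY.lintegral_exp_mul_sq_le hα.le (hCle.trans_lt hlt)).trans
    (ENNReal.ofReal_le_ofReal (Real.rpow_le_rpow_of_nonpos (by linarith) (by linarith) ?_))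
  norm_num
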